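/- Let k be a field, n ≥ 2, h ∈ k[X] with h(0) ≠ 0 and deg h < n, and R = k[X,Y,Z]/(XⁿY - Z² - h(X)Z). Every k-algebra automorphism α of R satisfies α(x) = μx for some μ ∈ k* with h(μX) = h(X), and either α(z) = z + f(x) with f ∈ k[X] divisible by Xⁿ, or α(z) = -z + f(x) with f ∈ k[X] satisfying f(X) ≡ -h(X) (mod Xⁿ). -/

import Mathlib

noncomputable section

/-- The defining relation `XⁿY - Z² - h(X)Z` in `k[X,Y,Z]` (variables `X 0, X 1, X 2`). -/
def danRel (k : Type*) [Field k] (n : ℕ) (h : Polynomial k) : MvPolynomial (Fin 3) k :=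
  MvPolynomial.X 0 ^ n * MvPolynomial.X 1 - MvPolynomial.X 2 ^ 2
    - Polynomial.aeval (MvPolynomial.X 0 : MvPolynomial (Fin 3) k) h * MvPolynomial.X 2

/-- The coordinate ring `R = k[X,Y,Z]/(XⁿY - Z² - h(X)Z)` of a Danielewski surface. -/
abbrev DanRing (k : Type*) [Field k] (n : ℕ) (h : Polynomial k) : Type _ :=
  MvPolynomial (Fin 3) k ⧸ Ideal.span {danRel k n h}

/-- The image `x` of `X` in `R`. -/
def dx (k : Type*) [Field k] (n : ℕ) (h : Polynomial k) : DanRing k n h :=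
  Ideal.Quotient.mk _ (MvPolynomial.X 0)

/-- The image `y` of `Y` in `R`. -/
def dy (k : Type*) [Field k] (n : ℕ) (h : Polynomial k) : DanRing k n h :=
  Ideal.Quotient.mk _ (MvPolynomial.X 1)

/-- The image `z` of `Z` in `R`. -/
def dz (k : Type*) [Field k] (n : ℕ) (h : Polynomial k) : DanRing k n h :=
  Ideal.Quotient.mk _ (MvPolynomial.X 2)

open Polynomial in
/-- An exponential map `exp : A → A[t]` on a ring `A` embedded in a polynomial ring `B[Z]`, together
with a weight `τ` for `t` such that `exp` does not raise the `Z`-degree. -/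
structure WeightedExp (A B : Type*) [CommRing A] [CommRing B] [IsDomain B] where
  emb : A →+* B[X]
  emb_injective : Function.Injective emb
  exp : A →+* A[X]
  exp_coeff_zero : ∀ g, (exp g).coeff 0 = g
  exp_coeff_coeff : ∀ g i j,
    (exp ((exp g).coeff i)).coeff j = (i + j).choose i • (exp g).coeff (i + j)
  τ : ℚ
  bound : ∀ g i, (exp g).coeff i ≠ 0 →
    (((emb ((exp g).coeff i)).natDegree : ℚ) + τ * i ≤ (emb g).natDegree)

namespace WeightedExp

open Polynomial

variable {A B : Type*} [CommRing A] [CommRing B] [IsDomain B] (W : WeightedExp A B)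

/-- The `Z`-degree of an element. -/
def deg (g : A) : ℕ := (W.emb g).natDegree

/-- The coefficient of `t ^ i` in `exp g`. -/
def D (i : ℕ) (g : A) : A := (W.exp g).coeff i

/-- The coefficient of `t ^ i` in `exp g` attains the weight of `g`. -/
def Active (g : A) (i : ℕ) : Prop := W.D i g ≠ 0 ∧ (W.deg (W.D i g) : ℚ) + W.τ * i = W.deg g

open Classical in
/-- The largest `i` such that `D i g` attains the weight of `g`: the `t`-degree of the leading
form of `exp g`. -/
def order (g : A) : ℕ := Nat.findGreatest (W.Active g) (W.exp g).natDegree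

lemma emb_ne_zero {g : A} (hg : g ≠ 0) : W.emb g ≠ 0 := fun h =>
  hg (W.emb_injective (by rw [h, map_zero]))

lemma isDomain (W : WeightedExp A B) : IsDomain A := W.emb_injective.isDomain W.emb

lemma mul_ne_zero (W : WeightedExp A B) {f g : A} (hf : f ≠ 0) (hg : g ≠ 0) : f * g ≠ 0 := by
  have := W.isDomain
  exact _root_.mul_ne_zero hf hg

lemma deg_mul {f g : A} (hf : f ≠ 0) (hg : g ≠ 0) : W.deg (f * g) = W.deg f + W.deg g := by
  rw [deg, map_mul, natDegree_mul (W.emb_ne_zero hf) (W.emb_ne_zero hg)]; rfl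

lemma deg_add_le (f g : A) : W.deg (f + g) ≤ max (W.deg f) (W.deg g) := by
  rw [deg, map_add]; exact natDegree_add_le _ _

lemma deg_add_of_lt {f g : A} (h : W.deg g < W.deg f) : W.deg (f + g) = W.deg f := by
  rw [deg, map_add]; exact natDegree_add_eq_left_of_natDegree_lt h

lemma D_zero (g : A) : W.D 0 g = g := W.exp_coeff_zero g

lemma D_add (i : ℕ) (f g : A) : W.D i (f + g) = W.D i f + W.D i g := by simp [D]

lemma D_mul (i : ℕ) (f g : A) :
    W.D i (f * g) = ∑ x ∈ Finset.HasAntidiagonal.antidiagonal i, W.D x.1 f * W.D x.2 g := by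
  simp [D, coeff_mul]

lemma D_D (g : A) (i j : ℕ) : W.D j (W.D i g) = (i + j).choose i • W.D (i + j) g :=
  W.exp_coeff_coeff g i j

lemma deg_D_le {g : A} {i : ℕ} (h : W.D i g ≠ 0) : (W.deg (W.D i g) : ℚ) + W.τ * i ≤ W.deg g :=
  W.bound g i h

lemma active_zero {g : A} (hg : g ≠ 0) : W.Active g 0 := by
  simp [Active, D_zero, hg]

lemma active_order {g : A} (hg : g ≠ 0) : W.Active g (W.order g) := by
  classical
  unfold order
  exact Nat.findGreatest_spec (P := W.Active g) (Nat.zero_le _) (W.active_zero hg)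

lemma Active.le_order {W : WeightedExp A B} {g : A} {i : ℕ} (h : W.Active g i) :
    i ≤ W.order g := by
  classical
  unfold order
  exact Nat.le_findGreatest (le_natDegree_of_ne_zero h.1) h

lemma order_eq {g : A} {N : ℕ} (h : W.Active g N) (h' : ∀ i, W.Active g i → i ≤ N) :
    W.order g = N := by
  have hg : g ≠ 0 := by
    rintro rfl
    exact h.1 (by simp [D])
  exact le_antisymm (h' _ (W.active_order hg)) h.le_order

/-- A strict upper bound for the degree which is vacuous for zero. -/
def DegLT (g : A) (c : ℚ) : Prop := g ≠ 0 → (W.deg g : ℚ) < c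

lemma DegLT.add {W : WeightedExp A B} {f g : A} {c : ℚ} (hf : W.DegLT f c) (hg : W.DegLT g c) :
    W.DegLT (f + g) c := by
  intro h
  by_cases h1 : f = 0
  · subst h1; rw [zero_add] at h ⊢; exact hg h
  by_cases h2 : g = 0
  · subst h2; rw [add_zero] at h ⊢; exact hf h
  have := W.deg_add_le f g
  have h3 : (W.deg (f + g) : ℚ) ≤ max (W.deg f : ℚ) (W.deg g) := by exact_mod_cast this
  exact h3.trans_lt (max_lt (hf h1) (hg h2))

lemma DegLT.sum {W : WeightedExp A B} {σ : Type*} (s : Finset σ) (f : σ → A) {c : ℚ}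
    (h : ∀ i ∈ s, W.DegLT (f i) c) : W.DegLT (∑ i ∈ s, f i) c := by
  classical
  induction s using Finset.induction_on with
  | empty => intro h; simp at h
  | insert a s ha ih =>
    rw [Finset.sum_insert ha]
    exact (h a (Finset.mem_insert_self _ _)).add
      (ih fun i hi => h i (Finset.mem_insert_of_mem hi))

lemma add_degLT {f g : A} (hf : f ≠ 0) (hg : W.DegLT g (W.deg f)) :
    f + g ≠ 0 ∧ W.deg (f + g) = W.deg f := by
  by_cases h2 : g = 0
  · subst h2; simpa using hf
  have h := hg h2
  have h' : W.deg g < W.deg f := by exact_mod_cast h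
  have := W.deg_add_of_lt h'
  refine ⟨fun h0 => ?_, this⟩
  rw [h0, deg, map_zero, natDegree_zero] at this
  omega

lemma degLT_of_not_active {g : A} {i : ℕ} (h : ¬ W.Active g i) :
    W.DegLT (W.D i g) (W.deg g - W.τ * i) := fun h0 => by
  have h1 := W.deg_D_le h0
  have h2 : (W.deg (W.D i g) : ℚ) + W.τ * i ≠ W.deg g := fun h3 => h ⟨h0, h3⟩
  have := lt_of_le_of_ne h1 h2
  linarith

lemma order_mul {f g : A} (hf : f ≠ 0) (hg : g ≠ 0) :
    W.order (f * g) = W.order f + W.order g := by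
  have hterm : ∀ i j, ¬ (W.Active f i ∧ W.Active g j) →
      W.DegLT (W.D i f * W.D j g) (W.deg (f * g) - W.τ * ((i + j : ℕ) : ℚ)) := by
    intro i j hij h0
    have hi : W.D i f ≠ 0 := left_ne_zero_of_mul h0
    have hj : W.D j g ≠ 0 := right_ne_zero_of_mul h0
    rw [W.deg_mul hi hj, W.deg_mul hf hg]
    push_cast
    have h1 := W.deg_D_le hi
    have h2 := W.deg_D_le hj
    by_cases ha : W.Active f i
    · have := W.degLT_of_not_active (fun hb => hij ⟨ha, hb⟩) hj
      linarith
    · have := W.degLT_of_not_active ha hi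
      linarith
  refine W.order_eq ?_ ?_
  · obtain ⟨a1, a2⟩ := W.active_order hf
    obtain ⟨b1, b2⟩ := W.active_order hg
    have hne := W.mul_ne_zero a1 b1
    have hmem : (W.order f, W.order g) ∈
        Finset.HasAntidiagonal.antidiagonal (W.order f + W.order g) := by simp
    have hdeg : (W.deg (W.D (W.order f) f * W.D (W.order g) g) : ℚ) =
        W.deg (f * g) - W.τ * ((W.order f + W.order g : ℕ) : ℚ) := by
      rw [W.deg_mul a1 b1, W.deg_mul hf hg]; push_cast; linarith
    have hlt : W.DegLT (∑ x ∈ (Finset.HasAntidiagonal.antidiagonal (W.order f + W.order g)).erase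
        (W.order f, W.order g), W.D x.1 f * W.D x.2 g)
        (W.deg (W.D (W.order f) f * W.D (W.order g) g)) := by
      refine DegLT.sum _ _ ?_
      rintro ⟨i, j⟩ hij
      rw [Finset.mem_erase, Finset.HasAntidiagonal.mem_antidiagonal] at hij
      rw [hdeg, ← hij.2]
      refine hterm i j ?_
      rintro ⟨ha, hb⟩
      have h1 := ha.le_order
      have h2 := hb.le_order
      have h3 := hij.2
      simp only at h3
      exact hij.1 (Prod.ext (by simp only; omega) (by simp only; omega))
    have hD := W.D_mul (W.order f + W.order g) f g
    rw [← Finset.add_sum_erase _ _ hmem] at hD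
    have := W.add_degLT hne hlt
    rw [← hD] at this
    refine ⟨this.1, ?_⟩
    rw [this.2, hdeg]; ring
  · intro i hi
    by_contra hlt
    push Not at hlt
    have : W.DegLT (W.D i (f * g)) (W.deg (f * g) - W.τ * i) := by
      rw [W.D_mul]
      refine DegLT.sum _ _ ?_
      rintro ⟨a, b⟩ hab
      rw [Finset.HasAntidiagonal.mem_antidiagonal] at hab
      rw [← hab]
      refine hterm a b ?_
      rintro ⟨ha, hb⟩
      have h1 := ha.le_order
      have h2 := hb.le_order
      simp only at hab
      omega
    have h1 := this hi.1
    have h2 := hi.2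
    linarith

lemma order_one : W.order (1 : A) = 0 := by
  have h1 : (1 : A) ≠ 0 := by
    intro h
    have := congrArg W.emb h
    simp at this
  have := W.order_mul h1 h1
  simp at this
  exact this

lemma order_pow {f : A} (hf : f ≠ 0) (m : ℕ) : W.order (f ^ m) = m * W.order f := by
  have := W.isDomain
  induction m with
  | zero => simp [order_one]
  | succ m ih => rw [pow_succ, W.order_mul (pow_ne_zero _ hf) hf, ih]; ring

lemma order_add {f g : A} (hf : f ≠ 0) (hg : W.DegLT g (W.deg f)) :
    W.order (f + g) = W.order f := by
  have hd := W.add_degLT hf hg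
  have key : ∀ i, W.DegLT (W.D i g) (W.deg f - W.τ * i) := fun i h => by
    have hg0 : g ≠ 0 := by
      rintro rfl
      exact h (by simp [D])
    have h1 := W.deg_D_le h
    have h2 := hg hg0
    linarith
  refine W.order_eq ?_ ?_
  · obtain ⟨a1, a2⟩ := W.active_order hf
    have hk : W.DegLT (W.D (W.order f) g) (W.deg (W.D (W.order f) f)) := by
      have := key (W.order f)
      rwa [← a2, add_sub_cancel_right] at this
    have := W.add_degLT a1 hk
    rw [← D_add] at this
    exact ⟨this.1, by rw [this.2, hd.2, a2]⟩
  · intro i hi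
    by_contra hlt
    push Not at hlt
    have h1 : ¬ W.Active f i := fun h => by have := h.le_order; omega
    have h2 := (W.degLT_of_not_active h1).add (key i)
    rw [← D_add] at h2
    have h3 := h2 hi.1
    have h4 := hi.2
    rw [hd.2] at h4
    linarith

lemma deg_nsmul {m : ℕ} {g : A} (hg : m • g ≠ 0) : W.deg (m • g) = W.deg g := by
  have h1 : (m : A) ≠ 0 := by
    intro h
    rw [nsmul_eq_mul, h, zero_mul] at hg
    exact hg rfl
  have h2 : g ≠ 0 := by
    rintro rfl
    simp at hg
  rw [nsmul_eq_mul, W.deg_mul h1 h2, deg, map_natCast, natDegree_natCast, zero_add]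

lemma Active.order_D_add_le {W : WeightedExp A B} {g : A} {i : ℕ} (h : W.Active g i) :
    W.order (W.D i g) + i ≤ W.order g := by
  obtain ⟨a1, a2⟩ := W.active_order h.1
  set j := W.order (W.D i g)
  rw [D_D] at a1 a2
  rw [W.deg_nsmul a1] at a2
  have : W.Active g (i + j) := by
    refine ⟨fun h0 => a1 (by rw [h0, smul_zero]), ?_⟩
    have := h.2
    push_cast
    linarith
  have := this.le_order
  omega

lemma active_of_choose {g : A} (hg : g ≠ 0) {r : ℕ} (hr : r ≤ W.order g)
    (hc : (((W.order g).choose r : ℕ) : A) ≠ 0) :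
    W.Active g (W.order g - r) ∧ W.order (W.D (W.order g - r) g) = r := by
  obtain ⟨a1, a2⟩ := W.active_order hg
  obtain ⟨s, hs⟩ := Nat.exists_eq_add_of_le' hr
  have hsr : W.order g - r = s := by omega
  rw [hsr]
  have hD := W.D_D g s r
  rw [← hs] at hD
  have hch : (W.order g).choose s = (W.order g).choose r := by
    rw [hs, Nat.choose_symm_add]
  rw [hch] at hD
  have hne : W.D r (W.D s g) ≠ 0 := by
    rw [hD, nsmul_eq_mul]
    exact W.mul_ne_zero hc a1
  have hdeg : W.deg (W.D r (W.D s g)) = W.deg (W.D (W.order g) g) := by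
    rw [hD] at hne ⊢
    exact W.deg_nsmul hne
  have hne' : W.D s g ≠ 0 := by
    intro h
    rw [h] at hne
    exact hne (by simp [D])
  have h1 := W.deg_D_le hne
  have h2 := W.deg_D_le hne'
  have h3 : (W.order g : ℚ) = s + r := by exact_mod_cast hs
  rw [hdeg] at h1
  rw [h3] at a2
  have hact : W.Active g s := ⟨hne', by linarith⟩
  refine ⟨hact, le_antisymm ?_ ?_⟩
  · have := hact.order_D_add_le
    omega
  · have : W.Active (W.D s g) r := ⟨hne, by rw [hdeg]; linarith⟩
    exact this.le_order

end WeightedExp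

section Embedding

open Polynomial

variable {k : Type*} [Field k] {n : ℕ} {h : k[X]}

lemma dx_pow_mul_dy : dx k n h ^ n * dy k n h = dz k n h ^ 2 + aeval (dx k n h) h * dz k n h := by
  have h1 : (Ideal.Quotient.mk (Ideal.span {danRel k n h})) (danRel k n h) = 0 :=
    Ideal.Quotient.eq_zero_iff_mem.mpr (Ideal.mem_span_singleton_self _)
  have h2 : (Ideal.Quotient.mk (Ideal.span {danRel k n h}))
      (aeval (MvPolynomial.X 0 : MvPolynomial (Fin 3) k) h) = aeval (dx k n h) h :=
    (aeval_algHom_apply (Ideal.Quotient.mkₐ k (Ideal.span {danRel k n h}))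
      (MvPolynomial.X 0) h).symm
  have h3 : dx k n h ^ n * dy k n h - dz k n h ^ 2 -
      (Ideal.Quotient.mk (Ideal.span {danRel k n h}))
        (aeval (MvPolynomial.X 0 : MvPolynomial (Fin 3) k) h) * dz k n h = 0 := h1
  rw [h2] at h3
  linear_combination h3

/-- The algebra homomorphism from `R` determined by images of `x, y, z` satisfying the relation. -/
def danLift {S : Type*} [CommRing S] [Algebra k S] {a b c : S}
    (H : a ^ n * b = c ^ 2 + aeval a h * c) : DanRing k n h →ₐ[k] S :=
  Ideal.Quotient.liftₐ (Ideal.span {danRel k n h}) (MvPolynomial.aeval ![a, b, c]) (by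
    intro p hp
    rw [Ideal.mem_span_singleton] at hp
    obtain ⟨q, rfl⟩ := hp
    have h2 : (MvPolynomial.aeval ![a, b, c])
        (aeval (MvPolynomial.X 0 : MvPolynomial (Fin 3) k) h) = aeval a h := by
      rw [← aeval_algHom_apply]; simp
    rw [map_mul, danRel, map_sub, map_sub, map_mul, map_mul, h2]
    simp [H])

section Lift

variable {S : Type*} [CommRing S] [Algebra k S] {a b c : S}
    (H : a ^ n * b = c ^ 2 + aeval a h * c)

lemma danLift_dx : danLift H (dx k n h) = a := by
  change MvPolynomial.aeval ![a, b, c] (MvPolynomial.X 0) = a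
  simp

lemma danLift_dy : danLift H (dy k n h) = b := by
  change MvPolynomial.aeval ![a, b, c] (MvPolynomial.X 1) = b
  simp

lemma danLift_dz : danLift H (dz k n h) = c := by
  change MvPolynomial.aeval ![a, b, c] (MvPolynomial.X 2) = c
  simp

end Lift

lemma danRing_induction {P : DanRing k n h → Prop} (hC : ∀ a : k, P (algebraMap k _ a))
    (hadd : ∀ f g, P f → P g → P (f + g)) (hx : ∀ g, P g → P (g * dx k n h))
    (hy : ∀ g, P g → P (g * dy k n h)) (hz : ∀ g, P g → P (g * dz k n h)) (g : DanRing k n h) :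
    P g := by
  obtain ⟨q, rfl⟩ := Ideal.Quotient.mk_surjective g
  induction q using MvPolynomial.induction_on with
  | C a => exact hC a
  | add p q hp hq => rw [map_add]; exact hadd _ _ hp hq
  | mul_X p i hp =>
    rw [map_mul]
    fin_cases i
    · exact hx _ hp
    · exact hy _ hp
    · exact hz _ hp

lemma danRing_algHom_ext {S : Type*} [CommRing S] [IsDomain S] [Algebra k S]
    {φ ψ : DanRing k n h →ₐ[k] S} (hx0 : φ (dx k n h) ≠ 0) (hx : φ (dx k n h) = ψ (dx k n h))
    (hz : φ (dz k n h) = ψ (dz k n h)) : φ = ψ := by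
  have hy : φ (dy k n h) = ψ (dy k n h) := by
    have h1 := congrArg φ (dx_pow_mul_dy (k := k) (n := n) (h := h))
    have h2 := congrArg ψ (dx_pow_mul_dy (k := k) (n := n) (h := h))
    simp only [map_add, map_mul, map_pow, ← aeval_algHom_apply] at h1 h2
    rw [← hx, ← hz, ← h1] at h2
    exact (mul_left_cancel₀ (pow_ne_zero n hx0) h2).symm
  ext g
  induction g using danRing_induction with
  | hC a => rw [AlgHom.commutes, AlgHom.commutes]
  | hadd f g hf hg => rw [map_add, map_add, hf, hg]
  | hx g hg => rw [map_mul, map_mul, hg, hx]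
  | hy g hg => rw [map_mul, map_mul, hg, hy]
  | hz g hg => rw [map_mul, map_mul, hg, hz]

/-- The image of a polynomial in `k(X)`. -/
def toFrac (p : k[X]) : RatFunc k := algebraMap k[X] (RatFunc k) p

lemma toFrac_ne_zero {p : k[X]} (hp : p ≠ 0) : toFrac p ≠ 0 := by
  simpa [toFrac] using hp

lemma aeval_C_toFrac (p q : k[X]) :
    aeval (C (toFrac q) : (RatFunc k)[X]) p = C (toFrac (p.comp q)) := by
  have : (C (toFrac q) : (RatFunc k)[X]) =
      (CAlgHom.comp (IsScalarTower.toAlgHom k k[X] (RatFunc k))) q := rfl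
  rw [this, aeval_algHom_apply]
  rfl

variable (k n h) in
/-- The embedding of `R` into `k(x)[z]`. -/
def danEmb : DanRing k n h →ₐ[k] (RatFunc k)[X] :=
  danLift (a := C (toFrac X)) (b := C ((toFrac X ^ n)⁻¹) * (X ^ 2 + C (toFrac h) * X)) (c := X) (by
    rw [aeval_C_toFrac, ← mul_assoc, ← C_pow, ← C_mul,
      mul_inv_cancel₀ (pow_ne_zero _ (toFrac_ne_zero X_ne_zero))]
    simp)

lemma danEmb_dx : danEmb k n h (dx k n h) = C (toFrac X) := danLift_dx _

lemma danEmb_dy : danEmb k n h (dy k n h) =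
    C ((toFrac X ^ n)⁻¹) * (X ^ 2 + C (toFrac h) * X) := danLift_dy _

lemma danEmb_dz : danEmb k n h (dz k n h) = X := danLift_dz _

lemma danEmb_aeval_dx (p : k[X]) : danEmb k n h (aeval (dx k n h) p) = C (toFrac p) := by
  rw [← aeval_algHom_apply, danEmb_dx, aeval_C_toFrac, comp_X]

variable (k n h) in
/-- The elements `y ^ i`, `y ^ i * z`, which form a basis of `R` over `k[x]`, ordered by their
degree in `z`. -/
def danBasis (i : ℕ) : DanRing k n h := dy k n h ^ (i / 2) * dz k n h ^ (i % 2)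

lemma degree_danEmb_dy : (danEmb k n h (dy k n h)).degree = 2 := by
  have h1 : (toFrac (X : k[X]) ^ n)⁻¹ ≠ 0 :=
    inv_ne_zero (pow_ne_zero _ (toFrac_ne_zero X_ne_zero))
  rw [danEmb_dy, degree_C_mul h1]
  compute_degree!

lemma degree_danEmb_danBasis (i : ℕ) : (danEmb k n h (danBasis k n h i)).degree = i := by
  rw [danBasis, map_mul, map_pow, map_pow, degree_mul, degree_pow, degree_pow, degree_danEmb_dy,
    danEmb_dz, degree_X]
  have := Nat.div_add_mod i 2
  conv_rhs => rw [← this]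
  simp [mul_comm]

variable (k n h) in
/-- The map `∑ pᵢ Wⁱ ↦ ∑ pᵢ(x) bᵢ` from polynomials over `k[X]` to `R`, where `b` is the basis
`danBasis`. -/
def danSum : (k[X])[X] →+ DanRing k n h where
  toFun P := P.sum fun i p => aeval (dx k n h) p * danBasis k n h i
  map_zero' := by simp
  map_add' P Q := by
    apply sum_add_index
    · simp
    · intro i p q
      rw [map_add, add_mul]

lemma danSum_monomial (i : ℕ) (p : k[X]) :
    danSum k n h (monomial i p) = aeval (dx k n h) p * danBasis k n h i := by
  simp [danSum, sum_monomial_index]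

lemma danSum_surjective : Function.Surjective (danSum k n h) := by
  intro g
  change g ∈ Set.range (danSum k n h)
  rw [← AddMonoidHom.coe_range, SetLike.mem_coe]
  have key : ∀ c : DanRing k n h, (∀ i p, danSum k n h (monomial i p) * c ∈ (danSum k n h).range) →
      ∀ g ∈ (danSum k n h).range, g * c ∈ (danSum k n h).range := by
    rintro c hc _ ⟨P, rfl⟩
    induction P using Polynomial.induction_on' with
    | add P Q hP hQ => rw [map_add, add_mul]; exact add_mem hP hQ
    | monomial i p => exact hc i p
  induction g using danRing_induction with
  | hC a =>
    refine ⟨monomial 0 (C a), ?_⟩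
    rw [danSum_monomial]
    simp [danBasis]
  | hadd f g hf hg => exact add_mem hf hg
  | hx g hg =>
    refine key _ (fun i p => ⟨monomial i (p * X), ?_⟩) g hg
    rw [danSum_monomial, danSum_monomial, map_mul, aeval_X]
    ring
  | hy g hg =>
    refine key _ (fun i p => ⟨monomial (i + 2) p, ?_⟩) g hg
    rw [danSum_monomial, danSum_monomial, danBasis, danBasis]
    have h1 : (i + 2) / 2 = i / 2 + 1 := by omega
    have h2 : (i + 2) % 2 = i % 2 := by omega
    rw [h1, h2]
    ring
  | hz g hg =>
    refine key _ (fun i p => ?_) g hg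
    rcases Nat.even_or_odd' i with ⟨j, rfl | rfl⟩
    · refine ⟨monomial (2 * j + 1) p, ?_⟩
      rw [danSum_monomial, danSum_monomial, danBasis, danBasis]
      have h1 : (2 * j + 1) / 2 = j := by omega
      have h2 : (2 * j + 1) % 2 = 1 := by omega
      have h3 : 2 * j / 2 = j := by omega
      have h4 : 2 * j % 2 = 0 := by omega
      rw [h1, h2, h3, h4]
      ring
    · refine ⟨monomial (2 * j + 2) (p * X ^ n) - monomial (2 * j + 1) (p * h), ?_⟩
      rw [map_sub, danSum_monomial, danSum_monomial, danSum_monomial, danBasis, danBasis]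
      have h1 : (2 * j + 1) / 2 = j := by omega
      have h2 : (2 * j + 1) % 2 = 1 := by omega
      have h3 : (2 * j + 2) / 2 = j + 1 := by omega
      have h4 : (2 * j + 2) % 2 = 0 := by omega
      rw [h1, h2, h3, h4, map_mul, map_mul, map_pow, aeval_X]
      linear_combination
        (aeval (dx k n h) p) * dy k n h ^ j * dx_pow_mul_dy (k := k) (n := n) (h := h)

lemma degree_danEmb_danSum (P : (k[X])[X]) : (danEmb k n h (danSum k n h P)).degree = P.degree := by
  suffices H : ∀ N : ℕ, ∀ P : (k[X])[X], P.degree < N →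
      (danEmb k n h (danSum k n h P)).degree = P.degree from
    H (P.natDegree + 1) P (degree_le_natDegree.trans_lt (by exact_mod_cast Nat.lt_succ_self _))
  intro N
  induction N with
  | zero =>
    intro P hP
    have : P = 0 := by
      rw [← degree_eq_bot]
      rwa [Nat.cast_zero, Nat.WithBot.lt_zero_iff] at hP
    simp [this]
  | succ N ih =>
    intro P hP
    by_cases hP0 : P = 0
    · simp [hP0]
    have h1 := degree_eraseLead_lt hP0
    have h2 : P.eraseLead.degree < N := by
      refine h1.trans_le ?_
      rw [degree_eq_natDegree hP0] at hP ⊢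
      norm_cast at hP ⊢
      omega
    have h3 : (danEmb k n h (danSum k n h (monomial P.natDegree P.leadingCoeff))).degree =
        P.degree := by
      rw [danSum_monomial, map_mul, danEmb_aeval_dx,
        degree_C_mul (toFrac_ne_zero (leadingCoeff_ne_zero.mpr hP0)), degree_danEmb_danBasis,
        degree_eq_natDegree hP0]
    conv_lhs => rw [← P.eraseLead_add_monomial_natDegree_leadingCoeff]
    rw [map_add, map_add, degree_add_eq_right_of_degree_lt, h3]
    rw [h3, ih _ h2]
    exact h1

variable (k n h) in
lemma danEmb_injective : Function.Injective (danEmb k n h) := by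
  rw [injective_iff_map_eq_zero]
  intro g hg
  obtain ⟨P, rfl⟩ := danSum_surjective g
  have := degree_danEmb_danSum (k := k) (n := n) (h := h) P
  rw [hg, degree_zero, eq_comm, degree_eq_bot] at this
  rw [this, map_zero]

instance : IsDomain (DanRing k n h) := (danEmb_injective k n h).isDomain (danEmb k n h).toRingHom

/-- The leading form of a nonzero element of `R` with respect to the degree in `z`. -/
lemma exists_leading_form {g : DanRing k n h} (hg : g ≠ 0) : ∃ p : k[X], p ≠ 0 ∧
    ∃ g' : DanRing k n h, g = aeval (dx k n h) p * danBasis k n h (danEmb k n h g).natDegree + g' ∧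
      (g' ≠ 0 → (danEmb k n h g').natDegree < (danEmb k n h g).natDegree) := by
  obtain ⟨P, rfl⟩ := danSum_surjective g
  have hP : P ≠ 0 := by
    rintro rfl
    simp at hg
  have hd : ∀ Q : (k[X])[X], (danEmb k n h (danSum k n h Q)).natDegree = Q.natDegree := fun Q =>
    natDegree_eq_of_degree_eq (degree_danEmb_danSum Q)
  refine ⟨P.leadingCoeff, leadingCoeff_ne_zero.mpr hP, danSum k n h P.eraseLead, ?_, fun h0 => ?_⟩
  · rw [hd, ← danSum_monomial, ← map_add, add_comm, eraseLead_add_monomial_natDegree_leadingCoeff]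
  · rw [hd, hd]
    refine natDegree_lt_natDegree ?_ (degree_eraseLead_lt hP)
    rintro h1
    rw [h1, map_zero] at h0
    exact h0 rfl

lemma natDegree_danEmb_danBasis (i : ℕ) : (danEmb k n h (danBasis k n h i)).natDegree = i :=
  natDegree_eq_of_degree_eq_some (degree_danEmb_danBasis i)

lemma aeval_dx_ne_zero {p : k[X]} (hp : p ≠ 0) : aeval (dx k n h) p ≠ 0 := by
  intro h0
  have := danEmb_aeval_dx (n := n) (h := h) p
  rw [h0, map_zero, eq_comm, C_eq_zero] at this
  exact toFrac_ne_zero hp this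

lemma danBasis_ne_zero (i : ℕ) : danBasis k n h i ≠ 0 := by
  intro h0
  have := degree_danEmb_danBasis (k := k) (n := n) (h := h) i
  rw [h0, map_zero, degree_zero] at this
  exact WithBot.bot_ne_coe this

end Embedding

section Exponential

open Polynomial

lemma coeff_aeval_C_X_add {F : Type*} [Field F] (c : F) (f : F[X]) (i : ℕ) :
    (aeval (C X + C (C c) * X : F[X][X]) f).coeff i = C (c ^ i) * hasseDeriv i f := by
  have h1 : aeval (C X + C (C c) * X : F[X][X]) f =
      (taylor X (f.map C)).comp (C (C c) * X) := by
    rw [taylor_apply, comp_assoc, comp, eval₂_map, aeval_def]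
    congr 1
    simp [add_comm]
  have h2 : hasseDeriv i (f.map (C : F →+* F[X])) = (hasseDeriv i f).map C := by
    ext1 j
    simp [hasseDeriv_coeff]
  rw [h1, comp_C_mul_X_coeff, taylor_coeff, h2, eval_map, eval₂_C_X, C_pow, mul_comm]

variable {k : Type*} [Field k] {n : ℕ} {h : k[X]}

variable (k n h) in
/-- The exponential map `x ↦ x`, `z ↦ z + xⁿ t` of `R`. -/
def danExp : DanRing k n h →ₐ[k] (DanRing k n h)[X] :=
  danLift (a := C (dx k n h))
    (b := C (dy k n h) + C (2 * dz k n h + aeval (dx k n h) h) * X + C (dx k n h ^ n) * X ^ 2)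
    (c := C (dz k n h) + C (dx k n h ^ n) * X) (by
      have h1 : aeval (C (dx k n h)) h = C (aeval (dx k n h) h) :=
        aeval_algHom_apply (CAlgHom : DanRing k n h →ₐ[k] (DanRing k n h)[X]) (dx k n h) h
      have h2 := congrArg (C : DanRing k n h → (DanRing k n h)[X])
        (dx_pow_mul_dy (k := k) (n := n) (h := h))
      simp only [map_add, map_mul, map_pow] at h2
      rw [h1]
      simp only [map_add, map_mul, map_pow, map_ofNat]
      linear_combination h2)

lemma danExp_dx : danExp k n h (dx k n h) = C (dx k n h) := danLift_dx _

lemma danExp_dz : danExp k n h (dz k n h) = C (dz k n h) + C (dx k n h ^ n) * X := danLift_dz _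

lemma danEmb_coeff_danExp (g : DanRing k n h) (i : ℕ) :
    danEmb k n h ((danExp k n h g).coeff i) =
      C ((toFrac X ^ n) ^ i) * hasseDeriv i (danEmb k n h g) := by
  rw [← coeff_aeval_C_X_add]
  have key : (mapAlgHom (danEmb k n h)).comp (danExp k n h) =
      ((aeval (C X + C (C (toFrac X ^ n)) * X :
        (RatFunc k)[X][X])).restrictScalars k).comp (danEmb k n h) := by
    apply danRing_algHom_ext (k := k) (n := n) (h := h)
    · simpa [danExp_dx, danEmb_dx] using toFrac_ne_zero (X_ne_zero (R := k))
    · simp [danExp_dx, danEmb_dx]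
    · simp [danExp_dz, danEmb_dz, danEmb_dx]
  have := congrArg (fun φ => (φ g).coeff i) key
  simpa using this

lemma coeff_zero_danExp (g : DanRing k n h) : (danExp k n h g).coeff 0 = g := by
  apply danEmb_injective k n h
  rw [danEmb_coeff_danExp]
  simp

lemma coeff_danExp_coeff (g : DanRing k n h) (i j : ℕ) :
    (danExp k n h ((danExp k n h g).coeff i)).coeff j =
      (i + j).choose i • (danExp k n h g).coeff (i + j) := by
  apply danEmb_injective k n h
  rw [map_nsmul, danEmb_coeff_danExp, danEmb_coeff_danExp, danEmb_coeff_danExp, ← smul_eq_C_mul,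
    ← smul_eq_C_mul, ← smul_eq_C_mul, map_smul, smul_smul, ← LinearMap.comp_apply, hasseDeriv_comp,
    ← pow_add, add_comm j i, LinearMap.smul_apply, smul_comm, Nat.choose_symm_add]

lemma danExp_coeff_one_ne_zero : (danExp k n h (dz k n h)).coeff 1 ≠ 0 := by
  rw [danExp_dz]
  have := aeval_dx_ne_zero (k := k) (n := n) (h := h) (pow_ne_zero n (X_ne_zero (R := k)))
  rw [map_pow, aeval_X] at this
  simpa only [coeff_add, coeff_C_succ, coeff_C_mul, coeff_X_one, mul_one, zero_add] using this

end Exponential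

/-- If `l` is a lower bound for all `r > 0` such that `l.choose r` or `l'.choose r` is nonzero in
a field, then `l` divides `l'`. -/
lemma dvd_of_forall_choose_ne_zero (k : Type*) [Field k] {l l' : ℕ} (hl : 0 < l) (hl' : 0 < l')
    (H : ∀ r, 0 < r → r ≤ l → ((l.choose r : ℕ) : k) ≠ 0 → l ≤ r)
    (H' : ∀ r, 0 < r → r ≤ l' → ((l'.choose r : ℕ) : k) ≠ 0 → l ≤ r) : l ∣ l' := by
  obtain ⟨p, hp⟩ := CharP.exists k
  rcases CharP.char_is_prime_or_zero k p with hpp | rfl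
  · have := Fact.mk hpp
    have key : ∀ v m : ℕ, ¬ p ∣ m → (((p ^ v * m).choose (p ^ v) : ℕ) : k) ≠ 0 := by
      intro v m hm h0
      rw [CharP.cast_eq_zero_iff k p] at h0
      have h1 : (p ^ v * m).choose (p ^ v * 1) ≡ m.choose 1 [MOD p] :=
        Choose.choose_pow_mul_pow_mul_modEq_choose_nat
      rw [mul_one, Nat.choose_one_right] at h1
      exact hm ((h1.dvd_iff dvd_rfl).mp h0)
    obtain ⟨v, m, hm, hv⟩ := Nat.exists_eq_pow_mul_and_not_dvd hl.ne' p hpp.ne_one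
    obtain ⟨v', m', hm', hv'⟩ := Nat.exists_eq_pow_mul_and_not_dvd hl'.ne' p hpp.ne_one
    have h1 := H (p ^ v) (pow_pos hpp.pos _) (Nat.le_of_dvd hl ⟨m, hv⟩)
      (by rw [hv]; exact key v m hm)
    have h2 := H' (p ^ v') (pow_pos hpp.pos _) (Nat.le_of_dvd hl' ⟨m', hv'⟩)
      (by rw [hv']; exact key v' m' hm')
    have h3 : l = p ^ v := le_antisymm h1 (Nat.le_of_dvd hl ⟨m, hv⟩)
    rw [h3] at h2 ⊢
    exact (pow_dvd_pow p ((Nat.pow_le_pow_iff_right hpp.one_lt).mp h2)).trans ⟨m', hv'⟩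
  · have := CharP.charP_to_charZero k
    have := H 1 one_pos hl (by rw [Nat.choose_one_right]; exact_mod_cast hl.ne')
    have h1 : l = 1 := le_antisymm this hl
    rw [h1]
    exact one_dvd _

section Weight

open Polynomial

variable {k : Type*} [Field k] {n : ℕ} {h : k[X]}

/-- An upper bound for the `z`-degree which is vacuous for zero. -/
def ZDegLE (g : DanRing k n h) (c : ℚ) : Prop :=
  g ≠ 0 → ((danEmb k n h g).natDegree : ℚ) ≤ c

lemma ZDegLE.add {f g : DanRing k n h} {c : ℚ} (hf : ZDegLE f c) (hg : ZDegLE g c) :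
    ZDegLE (f + g) c := by
  intro h0
  by_cases h1 : f = 0
  · subst h1; rw [zero_add] at h0 ⊢; exact hg h0
  by_cases h2 : g = 0
  · subst h2; rw [add_zero] at h0 ⊢; exact hf h0
  have h3 : ((danEmb k n h (f + g)).natDegree : ℚ) ≤
      max ((danEmb k n h f).natDegree : ℚ) ((danEmb k n h g).natDegree) := by
    rw [map_add]
    exact_mod_cast natDegree_add_le _ _
  exact h3.trans (max_le (hf h1) (hg h2))

lemma ZDegLE.sum {σ : Type*} (s : Finset σ) (f : σ → DanRing k n h) {c : ℚ}
    (H : ∀ i ∈ s, ZDegLE (f i) c) : ZDegLE (∑ i ∈ s, f i) c := by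
  classical
  induction s using Finset.induction_on with
  | empty => intro h0; simp at h0
  | insert a s ha ih =>
    rw [Finset.sum_insert ha]
    exact (H a (Finset.mem_insert_self _ _)).add
      (ih fun i hi => H i (Finset.mem_insert_of_mem hi))

lemma ZDegLE.mul {f g : DanRing k n h} {c d : ℚ} (hf : ZDegLE f c) (hg : ZDegLE g d) :
    ZDegLE (f * g) (c + d) := by
  intro h0
  have h1 := left_ne_zero_of_mul h0
  have h2 := right_ne_zero_of_mul h0
  have inj := danEmb_injective k n h
  rw [map_mul, natDegree_mul ((map_ne_zero_iff _ inj).mpr h1) ((map_ne_zero_iff _ inj).mpr h2)]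
  push_cast
  exact add_le_add (hf h1) (hg h2)

/-- The coefficients of a polynomial over `R` have weight at most `d`, if `t` has weight `τ`. -/
def WeightLE (τ : ℚ) (P : (DanRing k n h)[X]) (d : ℕ) : Prop :=
  ∀ i, ZDegLE (P.coeff i) (d - τ * i)

lemma WeightLE.add {τ : ℚ} {P Q : (DanRing k n h)[X]} {d : ℕ} (hP : WeightLE τ P d)
    (hQ : WeightLE τ Q d) : WeightLE τ (P + Q) d := fun i => by
  rw [coeff_add]; exact (hP i).add (hQ i)

lemma WeightLE.mul {τ : ℚ} {P Q : (DanRing k n h)[X]} {c d : ℕ} (hP : WeightLE τ P c)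
    (hQ : WeightLE τ Q d) : WeightLE τ (P * Q) (c + d) := fun i => by
  rw [coeff_mul]
  refine ZDegLE.sum _ _ fun x hx => ?_
  have h1 := (hP x.1).mul (hQ x.2)
  rw [Finset.HasAntidiagonal.mem_antidiagonal] at hx
  rw [← hx]
  push_cast
  convert h1 using 1
  ring

lemma WeightLE.mono {τ : ℚ} {P : (DanRing k n h)[X]} {c d : ℕ} (hP : WeightLE τ P c)
    (hcd : c ≤ d) : WeightLE τ P d := fun i h0 => by
  have h1 := hP i h0
  have h2 : (c : ℚ) ≤ d := by exact_mod_cast hcd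
  linarith

lemma weightLE_C {τ : ℚ} (a : k) : WeightLE τ (C (algebraMap k (DanRing k n h) a)) 0 := by
  rintro (_ | i)
  · intro _
    rw [coeff_C_zero, AlgHom.commutes, IsScalarTower.algebraMap_apply k (RatFunc k),
      algebraMap_eq, natDegree_C]
    simp
  · intro h0
    simp at h0

lemma WeightLE.pow {τ : ℚ} {P : (DanRing k n h)[X]} {d : ℕ} (hP : WeightLE τ P d) (m : ℕ) :
    WeightLE τ (P ^ m) (m * d) := by
  induction m with
  | zero => simpa using weightLE_C (k := k) (n := n) (h := h) 1
  | succ m ih =>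
    rw [pow_succ, add_one_mul]
    exact ih.mul hP

/-- It is enough to bound the weights of the images of the generators. -/
lemma weightLE_of_generators (Ψ : DanRing k n h →ₐ[k] (DanRing k n h)[X]) {τ : ℚ}
    (hx : WeightLE τ (Ψ (dx k n h)) 0) (hy : WeightLE τ (Ψ (dy k n h)) 2)
    (hz : WeightLE τ (Ψ (dz k n h)) 1) (g : DanRing k n h) :
    WeightLE τ (Ψ g) (danEmb k n h g).natDegree := by
  have hp : ∀ p : k[X], WeightLE τ (Ψ (aeval (dx k n h) p)) 0 := by
    intro p
    induction p using Polynomial.induction_on' with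
    | add p q hp hq => rw [map_add, map_add]; exact hp.add hq
    | monomial i a =>
      rw [aeval_monomial, map_mul, map_pow, AlgHom.commutes]
      exact (weightLE_C a).mul (hx.pow i)
  have hb : ∀ i, WeightLE τ (Ψ (danBasis k n h i)) i := by
    intro i
    rw [danBasis, map_mul, map_pow, map_pow]
    have := (hy.pow (i / 2)).mul (hz.pow (i % 2))
    rwa [mul_one, Nat.div_add_mod'] at this
  generalize hd : (danEmb k n h g).natDegree = d
  induction d using Nat.strong_induction_on generalizing g with
  | _ d ih =>
    by_cases hg : g = 0
    · subst hg
      intro i h0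
      simp at h0
    obtain ⟨p, -, g', hg', hlt⟩ := exists_leading_form hg
    rw [hd] at hg' hlt
    rw [hg', map_add, map_mul]
    refine WeightLE.add ?_ ?_
    · have := (hp p).mul (hb d)
      rwa [zero_add] at this
    · by_cases h0 : g' = 0
      · subst h0
        intro i h0
        simp at h0
      · exact (ih _ (hlt h0) g' rfl).mono (hlt h0).le

lemma eq_C_of_generators {Ψ : DanRing k n h →ₐ[k] (DanRing k n h)[X]}
    (hx : Ψ (dx k n h) = C (dx k n h)) (hy : Ψ (dy k n h) = C (dy k n h))
    (hz : Ψ (dz k n h) = C (dz k n h)) (g : DanRing k n h) : Ψ g = C g := by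
  induction g using danRing_induction with
  | hC a => rw [AlgHom.commutes]; rfl
  | hadd f g hf hg => rw [map_add, hf, hg, map_add]
  | hx g hg => rw [map_mul, hg, hx, map_mul]
  | hy g hg => rw [map_mul, hg, hy, map_mul]
  | hz g hg => rw [map_mul, hg, hz, map_mul]

/-- A nontrivial exponential map of `R` admits a weight for which one of the generators is moved by
the associated homogeneous exponential map. -/
lemma exists_weightedExp (Ψ : DanRing k n h →ₐ[k] (DanRing k n h)[X])
    (h0 : ∀ g, (Ψ g).coeff 0 = g)
    (hc : ∀ g i j, (Ψ ((Ψ g).coeff i)).coeff j = (i + j).choose i • (Ψ g).coeff (i + j))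
    (hne : ∃ g, Ψ g ≠ C g) :
    ∃ W : WeightedExp (DanRing k n h) (RatFunc k), W.emb = (danEmb k n h).toRingHom ∧
      W.exp = Ψ.toRingHom ∧
      ∃ i, 0 < i ∧ (W.Active (dx k n h) i ∨ W.Active (dy k n h) i ∨ W.Active (dz k n h) i) := by
  classical
  let S : Finset (Σ _ : DanRing k n h, ℕ) :=
    ({dx k n h, dy k n h, dz k n h} : Finset _).sigma fun g => (Ψ g).support.erase 0
  have hS : S.Nonempty := by
    by_contra hS
    rw [Finset.not_nonempty_iff_eq_empty] at hS
    have key : ∀ g, g = dx k n h ∨ g = dy k n h ∨ g = dz k n h → Ψ g = C g := by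
      intro g hg
      ext i
      rcases i with _ | i
      · rw [h0, coeff_C_zero]
      · rw [coeff_C_succ]
        by_contra hi
        have : (⟨g, i + 1⟩ : Σ _ : DanRing k n h, ℕ) ∈ S := by
          simpa [S, hi] using hg
        rw [hS] at this
        exact Finset.notMem_empty _ this
    obtain ⟨g, hg⟩ := hne
    exact hg (eq_C_of_generators (key _ (by simp)) (key _ (by simp)) (key _ (by simp)) g)
  obtain ⟨⟨g, i⟩, hgi, hmin⟩ := S.exists_min_image (fun q =>
    (((danEmb k n h q.1).natDegree : ℚ) - (danEmb k n h ((Ψ q.1).coeff q.2)).natDegree) / q.2) hS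
  set τ : ℚ := (((danEmb k n h g).natDegree : ℚ) -
    (danEmb k n h ((Ψ g).coeff i)).natDegree) / i with hτ
  have hgen : ∀ g, g = dx k n h ∨ g = dy k n h ∨ g = dz k n h →
      WeightLE τ (Ψ g) (danEmb k n h g).natDegree := by
    intro g hg j hj
    rcases j with _ | j
    · rw [h0]; simp
    · have := hmin ⟨g, j + 1⟩ (by simpa [S, hj] using hg)
      have hpos : (0 : ℚ) < ((j + 1 : ℕ) : ℚ) := by positivity
      have h2 : τ ≤ _ := this
      rw [le_div_iff₀ hpos] at h2
      linarith
  have hx : WeightLE τ (Ψ (dx k n h)) 0 := by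
    have := hgen (dx k n h) (by simp)
    rwa [danEmb_dx, natDegree_C] at this
  have hy : WeightLE τ (Ψ (dy k n h)) 2 := by
    have := hgen (dy k n h) (by simp)
    rwa [natDegree_eq_of_degree_eq_some degree_danEmb_dy] at this
  have hz : WeightLE τ (Ψ (dz k n h)) 1 := by
    have := hgen (dz k n h) (by simp)
    rwa [danEmb_dz, natDegree_X] at this
  let W : WeightedExp (DanRing k n h) (RatFunc k) :=
    { emb := (danEmb k n h).toRingHom
      emb_injective := danEmb_injective k n h
      exp := Ψ.toRingHom
      exp_coeff_zero := h0
      exp_coeff_coeff := hc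
      τ := τ
      bound := fun g i hi => by
        have := weightLE_of_generators Ψ hx hy hz g i hi
        change _ ≤ ((danEmb k n h g).natDegree : ℚ)
        have h2 : ((danEmb k n h ((Ψ g).coeff i)).natDegree : ℚ) + τ * i ≤
          (danEmb k n h g).natDegree := by linarith
        exact h2 }
  refine ⟨W, rfl, rfl, i, ?_, ?_⟩
  · simp only [S, Finset.mem_sigma, Finset.mem_erase] at hgi
    omega
  · simp only [S, Finset.mem_sigma, Finset.mem_erase, mem_support_iff] at hgi
    have hact : W.Active g i := by
      refine ⟨hgi.2.2, ?_⟩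
      change ((danEmb k n h ((Ψ g).coeff i)).natDegree : ℚ) + τ * i = (danEmb k n h g).natDegree
      have : (i : ℚ) ≠ 0 := by exact_mod_cast hgi.2.1
      rw [hτ]
      field_simp
      ring
    have hg := hgi.1
    simp only [Finset.mem_insert, Finset.mem_singleton] at hg
    rcases hg with rfl | rfl | rfl
    · exact .inl hact
    · exact .inr (.inl hact)
    · exact .inr (.inr hact)

end Weight

section Invariants

open Polynomial

variable {k : Type*} [Field k] {n : ℕ} {h : k[X]}
  {W : WeightedExp (DanRing k n h) (RatFunc k)}

lemma wdeg_eq (hW : W.emb = (danEmb k n h).toRingHom)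
    (g : DanRing k n h) : W.deg g = (danEmb k n h g).natDegree := by
  rw [WeightedExp.deg, hW]; rfl

lemma wdeg_aeval_dx (hW : W.emb = (danEmb k n h).toRingHom)
    (p : k[X]) : W.deg (aeval (dx k n h) p) = 0 := by
  rw [wdeg_eq hW, danEmb_aeval_dx, natDegree_C]

lemma wdeg_dx (hW : W.emb = (danEmb k n h).toRingHom) :
    W.deg (dx k n h) = 0 := by
  rw [wdeg_eq hW, danEmb_dx, natDegree_C]

lemma wdeg_dz (hW : W.emb = (danEmb k n h).toRingHom) :
    W.deg (dz k n h) = 1 := by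
  rw [wdeg_eq hW, danEmb_dz, natDegree_X]

lemma dx_ne_zero : dx k n h ≠ 0 := by
  simpa using aeval_dx_ne_zero (n := n) (h := h) (X_ne_zero (R := k))

lemma dz_ne_zero : dz k n h ≠ 0 := by
  simpa [danBasis] using danBasis_ne_zero (k := k) (n := n) (h := h) 1

lemma dy_ne_zero : dy k n h ≠ 0 := by
  simpa [danBasis] using danBasis_ne_zero (k := k) (n := n) (h := h) 2

/-- The order is determined by the leading form. -/
lemma exists_order_eq (hW : W.emb = (danEmb k n h).toRingHom)
    {g : DanRing k n h} (hg : g ≠ 0) : ∃ p : k[X], p ≠ 0 ∧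
    W.order g = W.order (aeval (dx k n h) p) +
      (W.deg g / 2 * W.order (dy k n h) + W.deg g % 2 * W.order (dz k n h)) := by
  obtain ⟨p, hp, g', hg', hlt⟩ := exists_leading_form hg
  refine ⟨p, hp, ?_⟩
  rw [← wdeg_eq hW g] at hg' hlt
  have h1 := aeval_dx_ne_zero (n := n) (h := h) hp
  have h2 := danBasis_ne_zero (k := k) (n := n) (h := h) (W.deg g)
  have h3 : W.DegLT g' (W.deg (aeval (dx k n h) p * danBasis k n h (W.deg g))) := by
    intro h0
    rw [W.deg_mul h1 h2, wdeg_aeval_dx hW, wdeg_eq hW (danBasis k n h _),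
      natDegree_danEmb_danBasis, zero_add, wdeg_eq hW g']
    exact_mod_cast hlt h0
  conv_lhs => rw [hg']
  rw [W.order_add (mul_ne_zero h1 h2) h3, W.order_mul h1 h2, danBasis,
    W.order_mul (pow_ne_zero _ dy_ne_zero) (pow_ne_zero _ dz_ne_zero),
    W.order_pow dy_ne_zero, W.order_pow dz_ne_zero]

lemma order_relation (hW : W.emb = (danEmb k n h).toRingHom) :
    n * W.order (dx k n h) + W.order (dy k n h) = 2 * W.order (dz k n h) := by
  have h1 := congrArg W.order (dx_pow_mul_dy (k := k) (n := n) (h := h))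
  rwa [W.order_mul (pow_ne_zero _ dx_ne_zero) dy_ne_zero, W.order_pow dx_ne_zero,
    W.order_add (pow_ne_zero 2 dz_ne_zero), W.order_pow dz_ne_zero] at h1
  intro h0
  rw [W.deg_mul (left_ne_zero_of_mul h0) dz_ne_zero, sq, W.deg_mul dz_ne_zero dz_ne_zero,
    wdeg_aeval_dx hW, wdeg_dz hW]
  norm_num

lemma order_algebraMap {a : k} (ha : a ≠ 0) : W.order (algebraMap k (DanRing k n h) a) = 0 := by
  have h1 : algebraMap k (DanRing k n h) a * algebraMap k _ a⁻¹ = 1 := by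
    rw [← map_mul, mul_inv_cancel₀ ha, map_one]
  have h2 := congrArg W.order h1
  rw [W.order_mul (left_ne_zero_of_mul_eq_one h1) (right_ne_zero_of_mul_eq_one h1),
    W.order_one] at h2
  omega

lemma order_aeval_dx (hW : W.emb = (danEmb k n h).toRingHom)
    {p : k[X]} (hp : p ≠ 0) : W.order (aeval (dx k n h) p) = 0 ∨
    W.order (dx k n h) ≤ W.order (aeval (dx k n h) p) := by
  have hp' : aeval (dx k n h) p = aeval (dx k n h) (p.divX * X) +
      algebraMap k (DanRing k n h) (p.coeff 0) := by
    conv_lhs => rw [← divX_mul_X_add p, map_add, aeval_C]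
  by_cases hd : p.divX = 0
  · left
    rw [hd, zero_mul, map_zero, zero_add] at hp'
    rw [hp']
    apply order_algebraMap
    intro h0
    exact aeval_dx_ne_zero (n := n) (h := h) hp (by rw [hp', h0, map_zero])
  right
  have h1 : aeval (dx k n h) (p.divX * X) ≠ 0 := aeval_dx_ne_zero (mul_ne_zero hd X_ne_zero)
  have h2 : W.order (dx k n h) ≤ W.order (aeval (dx k n h) (p.divX * X)) := by
    rw [map_mul, aeval_X, W.order_mul (aeval_dx_ne_zero hd) dx_ne_zero]
    omega
  refine h2.trans ?_
  rcases Nat.eq_zero_or_pos (W.order (aeval (dx k n h) (p.divX * X))) with h3 | h3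
  · rw [h3]; exact Nat.zero_le _
  obtain ⟨a1, a2⟩ := W.active_order h1
  set N := W.order (aeval (dx k n h) (p.divX * X))
  rw [wdeg_aeval_dx hW] at a2
  have h4 : W.DegLT (W.D N (algebraMap k (DanRing k n h) (p.coeff 0)))
      (W.deg (W.D N (aeval (dx k n h) (p.divX * X)))) := by
    have h5 : ¬ W.Active (algebraMap k (DanRing k n h) (p.coeff 0)) N := by
      intro h6
      by_cases hc : p.coeff 0 = 0
      · rw [hc, map_zero] at h6
        exact h6.1 (by simp [WeightedExp.D])
      have := h6.le_order
      rw [order_algebraMap hc] at this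
      omega
    have h6 := W.degLT_of_not_active h5
    rw [← aeval_C (dx k n h), wdeg_aeval_dx hW, ← a2, add_sub_cancel_right] at h6
    rwa [aeval_C] at h6
  have h5 := W.add_degLT a1 h4
  rw [← W.D_add, ← hp'] at h5
  have h6 : W.Active (aeval (dx k n h) p) N :=
    ⟨h5.1, by rw [h5.2, wdeg_aeval_dx hW, a2]⟩
  exact h6.le_order

/-- A homogeneous exponential map which moves one of the generators fixes no element of positive
degree. -/
lemma deg_eq_zero_of_order_eq_zero (hW : W.emb = (danEmb k n h).toRingHom)
    (hn : 2 ≤ n)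
    (hact : ∃ i, 0 < i ∧
      (W.Active (dx k n h) i ∨ W.Active (dy k n h) i ∨ W.Active (dz k n h) i))
    {f : DanRing k n h} (hf : f ≠ 0) (hf0 : W.order f = 0) : W.deg f = 0 := by
  by_contra hd
  have hrel := order_relation hW
  have hpos : 0 < W.order (dx k n h) + W.order (dy k n h) + W.order (dz k n h) := by
    obtain ⟨i, hi, h1 | h1 | h1⟩ := hact <;> have := h1.le_order <;> omega
  obtain ⟨p, hp, hord⟩ := exists_order_eq hW hf
  rw [hf0] at hord
  set l := W.order (dx k n h) with hl
  set l' := W.order (dz k n h) with hl'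
  have hxz : 2 * l ≤ n * l := Nat.mul_le_mul_right l hn
  have hz : 0 < l' := by omega
  have hmod : W.deg f % 2 = 0 := by
    rcases Nat.mod_two_eq_zero_or_one (W.deg f) with h1 | h1
    · exact h1
    · rw [h1] at hord; omega
  have hy : W.order (dy k n h) = 0 := by
    rcases Nat.eq_zero_or_pos (W.order (dy k n h)) with h1 | h1
    · exact h1
    · have h2 : 0 < W.deg f / 2 := by omega
      have := Nat.mul_pos h2 h1
      omega
  rw [hy, add_zero] at hrel
  have hx : 0 < l := by
    rcases Nat.eq_zero_or_pos l with h1 | h1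
    · rw [h1] at hrel; omega
    · exact h1
  have hlow : ∀ g : DanRing k n h, g ≠ 0 → W.order g < l → W.order g = 0 ∧ W.deg g % 2 = 0 := by
    intro g hg hlt
    obtain ⟨q, hq, hgq⟩ := exists_order_eq hW hg
    rw [hy, mul_zero, zero_add, ← hl'] at hgq
    have h1 := order_aeval_dx hW hq
    rcases Nat.mod_two_eq_zero_or_one (W.deg g) with h2 | h2
    · rw [h2] at hgq
      omega
    · rw [h2] at hgq
      omega
  have hchoose : ∀ {g : DanRing k n h}, g ≠ 0 → ∀ r, 0 < r → r ≤ W.order g →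
      (((W.order g).choose r : ℕ) : k) ≠ 0 → l ≤ r := by
    intro g hg r hr hrg hc
    by_contra hlt
    push Not at hlt
    have hc' : (((W.order g).choose r : ℕ) : DanRing k n h) ≠ 0 := by
      rw [← map_natCast (algebraMap k (DanRing k n h))]
      exact (map_ne_zero_iff _ (algebraMap k (DanRing k n h)).injective).mpr hc
    obtain ⟨h1, h2⟩ := W.active_of_choose hg hrg hc'
    have := hlow _ h1.1 (by omega)
    omega
  obtain ⟨c, hc⟩ : l ∣ l' := dvd_of_forall_choose_ne_zero k hx hz (hchoose dx_ne_zero)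
    (hchoose dz_ne_zero)
  have hn2 : n = 2 * c := by
    apply Nat.eq_of_mul_eq_mul_right hx
    rw [hrel, hc]; ring
  have hax := W.active_order (dx_ne_zero (k := k) (n := n) (h := h))
  have haz := W.active_order (dz_ne_zero (k := k) (n := n) (h := h))
  have h1 := hlow _ hax.1 (by have := hax.order_D_add_le; omega)
  have h2 := hlow _ haz.1 (by have := haz.order_D_add_le; omega)
  have h3 := hax.2
  have h4 := haz.2
  rw [wdeg_dx hW] at h3
  rw [wdeg_dz hW] at h4
  rw [← hl] at h3 h1
  rw [← hl'] at h4 h2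
  set d1 := W.deg (W.D l (dx k n h))
  set d2 := W.deg (W.D l' (dz k n h))
  have h5 : ((n * d1 + 2 : ℕ) : ℚ) = ((2 * d2 : ℕ) : ℚ) := by
    have h6 : (n : ℚ) * l = 2 * l' := by exact_mod_cast hrel
    push_cast at h3 h4 ⊢
    linear_combination (n : ℚ) * h3 - 2 * h4 - W.τ * h6
  have h6 : n * d1 + 2 = 2 * d2 := by exact_mod_cast h5
  obtain ⟨j, hj⟩ : 2 ∣ d1 := Nat.dvd_of_mod_eq_zero h1.2
  obtain ⟨j', hj'⟩ : 2 ∣ d2 := Nat.dvd_of_mod_eq_zero h2.2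
  rw [hj, hj', hn2] at h6
  have : 2 * c * (2 * j) = 4 * (c * j) := by ring
  omega

lemma eq_aeval_dx_of_natDegree_eq_zero {f : DanRing k n h}
    (hf : (danEmb k n h f).natDegree = 0) : ∃ p : k[X], f = aeval (dx k n h) p := by
  by_cases h0 : f = 0
  · exact ⟨0, by simp [h0]⟩
  obtain ⟨p, -, g', hg', hlt⟩ := exists_leading_form h0
  rw [hf] at hg' hlt
  have : g' = 0 := by
    by_contra h1
    exact Nat.not_lt_zero _ (hlt h1)
  exact ⟨p, by rw [hg', this, danBasis]; simp⟩

/-- The invariants of every nontrivial exponential map of `R` are contained in `k[x]`. -/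
theorem eq_aeval_dx_of_invariant (hn : 2 ≤ n) (Ψ : DanRing k n h →ₐ[k] (DanRing k n h)[X])
    (h0 : ∀ g, (Ψ g).coeff 0 = g)
    (hc : ∀ g i j, (Ψ ((Ψ g).coeff i)).coeff j = (i + j).choose i • (Ψ g).coeff (i + j))
    (hne : ∃ g, Ψ g ≠ C g) {f : DanRing k n h} (hf : Ψ f = C f) :
    ∃ p : k[X], f = aeval (dx k n h) p := by
  obtain ⟨W, hW, hΨ, hact⟩ := exists_weightedExp Ψ h0 hc hne
  apply eq_aeval_dx_of_natDegree_eq_zero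
  by_cases hf0 : f = 0
  · simp [hf0]
  rw [← wdeg_eq hW]
  refine deg_eq_zero_of_order_eq_zero hW hn hact hf0 ?_
  by_contra h1
  obtain ⟨m, hm⟩ := Nat.exists_eq_succ_of_ne_zero h1
  apply (W.active_order hf0).1
  rw [hm, WeightedExp.D, hΨ]
  change (Ψ f).coeff _ = 0
  rw [hf, coeff_C_succ]

lemma coeff_map_danExp (α : DanRing k n h ≃ₐ[k] DanRing k n h) (g : DanRing k n h) (i : ℕ) :
    (((mapAlgHom (α : DanRing k n h →ₐ[k] DanRing k n h)).comp ((danExp k n h).comp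
      (α.symm : DanRing k n h →ₐ[k] DanRing k n h))) g).coeff i =
      α ((danExp k n h (α.symm g)).coeff i) := by
  simp

/-- Every automorphism of `R` maps `x` into `k[x]`. -/
theorem exists_algEquiv_dx_eq (hn : 2 ≤ n) (α : DanRing k n h ≃ₐ[k] DanRing k n h) :
    ∃ p : k[X], α (dx k n h) = aeval (dx k n h) p := by
  refine eq_aeval_dx_of_invariant hn ((mapAlgHom (α : DanRing k n h →ₐ[k] DanRing k n h)).comp
    ((danExp k n h).comp (α.symm : DanRing k n h →ₐ[k] DanRing k n h))) (fun g => ?_)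
    (fun g i j => ?_) ⟨α (dz k n h), fun h0 => ?_⟩ ?_
  · rw [coeff_map_danExp, coeff_zero_danExp, AlgEquiv.apply_symm_apply]
  · rw [coeff_map_danExp, coeff_map_danExp, coeff_map_danExp, AlgEquiv.symm_apply_apply,
      coeff_danExp_coeff, map_nsmul]
  · have h1 := congrArg (fun P => P.coeff 1) h0
    rw [coeff_map_danExp, AlgEquiv.symm_apply_apply, coeff_C_succ] at h1
    exact danExp_coeff_one_ne_zero ((map_eq_zero_iff _ α.injective).mp h1)
  · simp [danExp_dx]

end Invariants

section Automorphisms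

open Polynomial

variable {k : Type*} [Field k] {n : ℕ} {h : k[X]}

lemma toFrac_injective : Function.Injective (toFrac : k[X] → RatFunc k) :=
  IsFractionRing.injective k[X] (RatFunc k)

lemma aeval_dx_mul_dz_add_inj {p q p' q' : k[X]}
    (H : aeval (dx k n h) p * dz k n h + aeval (dx k n h) q =
      aeval (dx k n h) p' * dz k n h + aeval (dx k n h) q') : p = p' ∧ q = q' := by
  have h1 := congrArg (danEmb k n h) H
  simp only [map_add, map_mul, danEmb_aeval_dx, danEmb_dz] at h1
  have h2 := congrArg (fun P => P.coeff 1) h1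
  have h3 := congrArg (fun P => P.coeff 0) h1
  simp only [coeff_add, coeff_C_mul, coeff_X_one, coeff_X_zero, mul_one, mul_zero, zero_add,
    coeff_C_zero, coeff_C_succ, add_zero] at h2 h3
  exact ⟨toFrac_injective h2, toFrac_injective h3⟩

variable (k n h) in
lemma aeval_dx_injective : Function.Injective (aeval (R := k) (dx k n h)) := fun p q H =>
  (aeval_dx_mul_dz_add_inj (p := 0) (p' := 0) (by rw [H])).2

lemma exists_eq_of_natDegree_le_one {g : DanRing k n h} (hg : (danEmb k n h g).natDegree ≤ 1) :
    ∃ p q : k[X], g = aeval (dx k n h) p * dz k n h + aeval (dx k n h) q := by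
  rcases Nat.lt_or_ge (danEmb k n h g).natDegree 1 with h1 | h1
  · obtain ⟨q, hq⟩ := eq_aeval_dx_of_natDegree_eq_zero (Nat.lt_one_iff.mp h1)
    exact ⟨0, q, by simp [hq]⟩
  have hd := le_antisymm hg h1
  have hg0 : g ≠ 0 := by
    rintro rfl
    simp at hd
  obtain ⟨p, -, g', hg', hlt⟩ := exists_leading_form hg0
  rw [hd] at hg' hlt
  obtain ⟨q, hq⟩ : ∃ q : k[X], g' = aeval (dx k n h) q := by
    by_cases h0 : g' = 0
    · exact ⟨0, by simp [h0]⟩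
    · exact eq_aeval_dx_of_natDegree_eq_zero (Nat.lt_one_iff.mp (hlt h0))
  refine ⟨p, q, ?_⟩
  rw [hg', hq]
  simp [danBasis]

lemma map_aeval_dx {S : Type*} [CommRing S] [Algebra k S] (φ : DanRing k n h →ₐ[k] S) (p : k[X]) :
    φ (aeval (dx k n h) p) = aeval (φ (dx k n h)) p :=
  (aeval_algHom_apply φ _ p).symm

lemma algEquiv_aeval_dx {α : DanRing k n h ≃ₐ[k] DanRing k n h} {p : k[X]}
    (hp : α (dx k n h) = aeval (dx k n h) p) (q : k[X]) :
    α (aeval (dx k n h) q) = aeval (dx k n h) (q.comp p) := by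
  rw [aeval_comp, ← hp]
  exact map_aeval_dx (α : DanRing k n h →ₐ[k] DanRing k n h) q

/-- An automorphism of `R` multiplies all degrees by the degree of the image of `z`. -/
lemma natDegree_danEmb_algEquiv {α : DanRing k n h ≃ₐ[k] DanRing k n h} {p : k[X]}
    (hp : α (dx k n h) = aeval (dx k n h) p) (g : DanRing k n h) :
    (danEmb k n h (α g)).natDegree =
      (danEmb k n h g).natDegree * (danEmb k n h (α (dz k n h))).natDegree := by
  have hinj : Function.Injective (aeval (R := k) (toFrac p)) := by
    intro q q' hqq
    have h1 : ∀ q : k[X], C (aeval (toFrac p) q) = danEmb k n h (α (aeval (dx k n h) q)) := by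
      intro q
      rw [algEquiv_aeval_dx hp, danEmb_aeval_dx, ← aeval_C_toFrac]
      exact (aeval_algHom_apply (CAlgHom : RatFunc k →ₐ[k] (RatFunc k)[X]) (toFrac p) q).symm
    have h2 := congrArg C hqq
    rw [h1, h1] at h2
    exact aeval_dx_injective k n h (α.injective (danEmb_injective k n h h2))
  let σ : RatFunc k →ₐ[k] RatFunc k := IsFractionRing.liftAlgHom hinj
  have hσ : σ (toFrac X) = toFrac p := by
    have : σ (toFrac X) = aeval (toFrac p) (X : k[X]) :=
      IsFractionRing.lift_algebraMap hinj X
    rw [this, aeval_X]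
  have key : (danEmb k n h).comp (α : DanRing k n h →ₐ[k] DanRing k n h) =
      ((aeval (danEmb k n h (α (dz k n h))) :
        (RatFunc k)[X] →ₐ[RatFunc k] (RatFunc k)[X]).restrictScalars k).comp
        ((mapAlgHom σ).comp (danEmb k n h)) := by
    apply danRing_algHom_ext (k := k) (n := n) (h := h)
    · intro h0
      exact dx_ne_zero (α.injective (danEmb_injective k n h (by simpa using h0)))
    · simp [hp, danEmb_aeval_dx, danEmb_dx, hσ, algebraMap_eq]
    · simp [danEmb_dz]
  have h1 : danEmb k n h (α g) =
      ((danEmb k n h g).map (σ : RatFunc k →+* RatFunc k)).comp (danEmb k n h (α (dz k n h))) :=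
    DFunLike.congr_fun key g
  conv_lhs => rw [h1]
  rw [natDegree_comp, natDegree_map]

lemma exists_algEquiv_dz_eq {α : DanRing k n h ≃ₐ[k] DanRing k n h} {p : k[X]}
    (hp : α (dx k n h) = aeval (dx k n h) p) :
    ∃ q f : k[X], α (dz k n h) = aeval (dx k n h) q * dz k n h + aeval (dx k n h) f := by
  apply exists_eq_of_natDegree_le_one
  have := natDegree_danEmb_algEquiv hp (α.symm (dz k n h))
  rw [AlgEquiv.apply_symm_apply, danEmb_dz, natDegree_X] at this
  exact (Nat.eq_one_of_mul_eq_one_left this.symm).le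

/-- Every automorphism of `R` is affine in `x` and in `z`. -/
lemma exists_algEquiv_eq (hn : 2 ≤ n) (α : DanRing k n h ≃ₐ[k] DanRing k n h) :
    ∃ a b c : k, ∃ f : k[X], a ≠ 0 ∧ c ≠ 0 ∧
      α (dx k n h) = aeval (dx k n h) (C a * X + C b) ∧
      α (dz k n h) = aeval (dx k n h) (C c) * dz k n h + aeval (dx k n h) f := by
  obtain ⟨p, hp⟩ := exists_algEquiv_dx_eq hn α
  obtain ⟨p', hp'⟩ := exists_algEquiv_dx_eq hn α.symm
  obtain ⟨q, f, hq⟩ := exists_algEquiv_dz_eq hp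
  obtain ⟨q', f', hq'⟩ := exists_algEquiv_dz_eq hp'
  have h1 : p'.comp p = X := by
    apply aeval_dx_injective k n h
    rw [← algEquiv_aeval_dx hp, ← hp', AlgEquiv.apply_symm_apply, aeval_X]
  have h2 : p.natDegree = 1 := by
    have := congrArg natDegree h1
    rw [natDegree_comp, natDegree_X] at this
    exact Nat.eq_one_of_mul_eq_one_left this
  have h3 : q'.comp p * q = 1 := by
    have h4 := congrArg α hq'
    rw [AlgEquiv.apply_symm_apply, map_add, map_mul, algEquiv_aeval_dx hp, algEquiv_aeval_dx hp,
      hq] at h4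
    refine (aeval_dx_mul_dz_add_inj (n := n) (h := h) (q := (q'.comp p) * f + f'.comp p) (q' := 0)
      ?_).1
    simp only [map_add, map_mul, map_one, map_zero]
    linear_combination -h4
  obtain ⟨c, hc, rfl⟩ := Polynomial.isUnit_iff.mp (IsUnit.of_mul_eq_one_right _ h3)
  obtain ⟨a, ha, b, rfl⟩ := natDegree_eq_one.mp h2
  exact ⟨a, b, c, f, ha, hc.ne_zero, hp, hq⟩

end Automorphisms

section Classification

open Polynomial

variable {k : Type*} [Field k] {n : ℕ} {h : k[X]}

/-- An automorphism of `R` which is affine in `x` and `z` fixes the origin of the `x`-line, the only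
point over which the fibre is reducible. -/
lemma algEquiv_translation_eq_zero (hn : n ≠ 0) {α : DanRing k n h ≃ₐ[k] DanRing k n h}
    {a b c : k} {f : k[X]} (ha : a ≠ 0) (hc : c ≠ 0)
    (hx : α (dx k n h) = aeval (dx k n h) (C a * X + C b))
    (hz : α (dz k n h) = aeval (dx k n h) (C c) * dz k n h + aeval (dx k n h) f) : b = 0 := by
  by_contra hb
  set r : k := -b / a with hr
  have hr0 : r ≠ 0 := div_ne_zero (neg_ne_zero.mpr hb) ha
  have hC : ∀ p : k[X], aeval (C r) p = C (p.eval r) := fun p =>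
    (aeval_algHom_apply (CAlgHom : k →ₐ[k] k[X]) r p)
  let φ : DanRing k n h →ₐ[k] k[X] := danLift (a := C r)
    (b := C ((r ^ n)⁻¹) * (X ^ 2 + C (h.eval r) * X)) (c := X) (by
      rw [hC, ← mul_assoc, ← C_pow, ← C_mul, mul_inv_cancel₀ (pow_ne_zero _ hr0)]
      simp)
  have hφx : φ (dx k n h) = C r := danLift_dx _
  have hφz : φ (dz k n h) = X := danLift_dz _
  have h1 : φ (α (dx k n h)) = 0 := by
    rw [hx, map_aeval_dx, hφx, hC]
    simp only [eval_add, eval_mul, eval_C, eval_X, hr]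
    rw [mul_div_cancel₀ _ ha, neg_add_cancel, C_0]
  have h2 : φ (α (dz k n h)) = C c * X + C (f.eval r) := by
    rw [hz, map_add, map_mul, map_aeval_dx, map_aeval_dx, hφx, hφz, hC, hC, eval_C]
  have h3 : φ (α (aeval (dx k n h) h)) = C (h.coeff 0) := by
    have h4 := map_aeval_dx (φ.comp (α : DanRing k n h →ₐ[k] DanRing k n h)) h
    have h5 : φ (α (aeval (dx k n h) h)) = aeval (φ (α (dx k n h))) h := h4
    rw [h5, h1, ← coeff_zero_eq_aeval_zero']
    rfl
  have h4 := congrArg (fun g => φ (α g)) (dx_pow_mul_dy (k := k) (n := n) (h := h))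
  simp only [map_add, map_mul, map_pow] at h4
  rw [h1, h2, h3, zero_pow hn, zero_mul] at h4
  have h5 : (C c * X + C (f.eval r)) * (C c * X + C (f.eval r + h.coeff 0)) = 0 := by
    rw [C_add]
    linear_combination -h4
  rcases mul_eq_zero.mp h5 with h6 | h6
  · exact hc (by simpa using congrArg (fun P => P.coeff 1) h6)
  · exact hc (by simpa using congrArg (fun P => P.coeff 1) h6)

/-- Divisibility by `xⁿ` in `R` of an element of degree at most one is tested on coefficients. -/
lemma X_pow_dvd_of_eq {g : DanRing k n h} {p q : k[X]}
    (H : dx k n h ^ n * g = aeval (dx k n h) p * dz k n h + aeval (dx k n h) q) :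
    X ^ n ∣ p ∧ X ^ n ∣ q := by
  have h1 : (danEmb k n h g).natDegree ≤ 1 := by
    have h2 := congrArg (fun g => (danEmb k n h g).natDegree) H
    simp only [map_add, map_mul, map_pow, danEmb_aeval_dx, danEmb_dx, danEmb_dz] at h2
    rw [← C_pow, natDegree_C_mul (pow_ne_zero n (toFrac_ne_zero X_ne_zero))] at h2
    rw [h2]
    compute_degree
  obtain ⟨p', q', rfl⟩ := exists_eq_of_natDegree_le_one h1
  have h2 := aeval_dx_mul_dz_add_inj (n := n) (h := h) (p := X ^ n * p') (q := X ^ n * q')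
    (p' := p) (q' := q) (by
      rw [← H, map_mul, map_mul, map_pow, aeval_X]
      ring)
  exact ⟨⟨p', h2.1.symm⟩, ⟨q', h2.2.symm⟩⟩

lemma algEquiv_X_pow_dvd {α : DanRing k n h ≃ₐ[k] DanRing k n h} {a c : k} {f : k[X]}
    (hx : α (dx k n h) = aeval (dx k n h) (C a * X))
    (hz : α (dz k n h) = aeval (dx k n h) (C c) * dz k n h + aeval (dx k n h) f) :
    X ^ n ∣ C c * (2 * f + h.comp (C a * X) - C c * h) ∧ X ^ n ∣ f * (f + h.comp (C a * X)) := by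
  have h1 := congrArg α (dx_pow_mul_dy (k := k) (n := n) (h := h))
  simp only [map_add, map_mul, map_pow] at h1
  rw [algEquiv_aeval_dx hx, hx, hz] at h1
  refine X_pow_dvd_of_eq (h := h)
    (g := aeval (dx k n h) (C a ^ n) * α (dy k n h) - aeval (dx k n h) (C c ^ 2) * dy k n h) ?_
  simp only [map_add, map_sub, map_mul, map_pow, map_ofNat, aeval_X] at h1 ⊢
  linear_combination h1 - (aeval (dx k n h) (C c)) ^ 2 * dx_pow_mul_dy (k := k) (n := n) (h := h)

/-- If `h(aX) ≡ ch(X)` modulo `Xⁿ`, then `c = 1` and `h(aX) = h(X)`. -/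
lemma comp_eq_of_X_pow_dvd (h0 : h.coeff 0 ≠ 0) (hdeg : h.natDegree < n) {a c : k}
    (H : X ^ n ∣ h.comp (C a * X) - C c * h) : c = 1 ∧ h.comp (C a * X) = h := by
  have h1 : h.comp (C a * X) - C c * h = 0 := by
    refine eq_zero_of_dvd_of_natDegree_lt H ?_
    rw [natDegree_X_pow]
    refine (natDegree_sub_le _ _).trans_lt (max_lt ?_ ?_)
    · refine natDegree_comp_le.trans_lt (lt_of_le_of_lt ?_ hdeg)
      have h2 : (C a * X : k[X]).natDegree ≤ 1 := (natDegree_C_mul_le _ _).trans natDegree_X_le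
      nlinarith
    · exact (natDegree_C_mul_le _ _).trans_lt hdeg
  have h2 := congrArg (fun P => P.coeff 0) h1
  simp only [coeff_sub, comp_C_mul_X_coeff, pow_zero, mul_one, coeff_C_mul, coeff_zero] at h2
  have h3 : c = 1 := by
    apply mul_right_cancel₀ h0
    linear_combination -h2
  rw [h3, C_1, one_mul, sub_eq_zero] at h1
  exact ⟨h3, h1⟩

end Classification

/-- Every `k`-algebra automorphism `α` of `R` satisfies `α(x) = μx` for some
`μ ∈ k*` with `h(μX) = h(X)`, and either `α(z) = z + f(x)` with `Xⁿ ∣ f`, or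
`α(z) = -z + f(x)` with `f ≡ -h (mod Xⁿ)`. -/
theorem stmt_15 (k : Type*) [Field k] (n : ℕ) (hn : 2 ≤ n)
    (h : Polynomial k) (h0 : h.coeff 0 ≠ 0) (hdeg : h.natDegree < n)
    (α : DanRing k n h ≃ₐ[k] DanRing k n h) :
    ∃ μ : k, μ ≠ 0 ∧ h.comp (Polynomial.C μ * Polynomial.X) = h ∧
      α (dx k n h) = algebraMap k (DanRing k n h) μ * dx k n h ∧
      ((∃ f : Polynomial k, Polynomial.X ^ n ∣ f ∧
          α (dz k n h) = dz k n h + Polynomial.aeval (dx k n h) f) ∨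
        (∃ f : Polynomial k, Polynomial.X ^ n ∣ (f + h) ∧
          α (dz k n h) = -dz k n h + Polynomial.aeval (dx k n h) f)) := by
  open Polynomial in
  obtain ⟨a, b, c, f, ha, hc, hx, hz⟩ := exists_algEquiv_eq hn α
  have hb := algEquiv_translation_eq_zero (by omega) ha hc hx hz
  rw [hb, C_0, add_zero] at hx
  obtain ⟨h1, h2⟩ := algEquiv_X_pow_dvd hx hz
  have h1 := (isUnit_C.mpr hc.isUnit).dvd_mul_left.mp h1
  have hx' : α (dx k n h) = algebraMap k (DanRing k n h) a * dx k n h := by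
    rw [hx, map_mul, aeval_C, aeval_X]
  rw [aeval_C] at hz
  by_cases hf : X ∣ f
  · have h3 : ¬ X ∣ f + h.comp (C a * X) := by
      rw [X_dvd_iff] at hf ⊢
      simpa [hf, comp_C_mul_X_coeff] using h0
    rw [mul_comm] at h2
    have h4 := prime_X.pow_dvd_of_dvd_mul_left n h3 h2
    obtain ⟨rfl, h5⟩ := comp_eq_of_X_pow_dvd (a := a) (c := c) h0 hdeg (by
      have := dvd_sub h1 (h4.mul_left 2)
      rwa [add_sub_assoc, add_sub_cancel_left] at this)
    refine ⟨a, ha, h5, hx', .inl ⟨f, h4, ?_⟩⟩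
    rw [hz, map_one, one_mul]
  · have h4 := prime_X.pow_dvd_of_dvd_mul_left n hf h2
    obtain ⟨h6, h5⟩ := comp_eq_of_X_pow_dvd (a := a) (c := -c) h0 hdeg (by
      have := dvd_sub (h4.mul_left 2) h1
      rw [C_neg]
      convert this using 1
      ring)
    obtain rfl : c = -1 := by rw [← h6, neg_neg]
    rw [h5] at h4
    refine ⟨a, ha, h5, hx', .inr ⟨f, h4, ?_⟩⟩
    rw [hz, map_neg, map_one]
    ring
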